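/- Let V be an sl₂-Hodge structure of weight n polarized by Q, let V = ⊕_{p+q=n} V♯^{p,q} with V♯^{p,q} = (e^Y F)^p ∩ (e^{−Y} F̄)^q be the associated polarized Hodge structure of weight n, and let End(V)^{j,−j} = {A ∈ End(V) : A(V♯^{p,q}) ⊆ V♯^{p+j,q−j} for all p,q} be the induced weight-0 Hodge decomposition of End(V). Writing A = Σ_j A_j with A_j ∈ End(V)^{j,−j} for the components of an endomorphism A, the operators H, X, Y decompose as follows: Y = Y_{−1} + Y_0 + Y_1 (i.e., Y_j = 0 for |j| ≥ 2), X = −Y_{−1} + Y_0 − Y_1, and H = −2Y_{−1} + 2Y_1; equivalently, 4Y_{−1} = Y − H − X, 2Y_0 = Y + X, and 4Y_1 = Y + H − X. -/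

import Mathlib

/-!
Hodge components of `H, X, Y` in a polarized sl₂-Hodge structure: with respect to the
weight-0 Hodge decomposition of `End(V)` induced by the associated Hodge structure
`V = ⊕ V♯^{p,q}`, the components `Y_j ∈ End(V)^{j,−j}` of `Y` are
`4Y_{−1} = Y − H − X`, `2Y_0 = Y + X`, `4Y_1 = Y + H − X` (and `Y_j = 0` for `|j| ≥ 2`),
so that `Y = Y_{−1} + Y_0 + Y_1`, `X = −Y_{−1} + Y_0 − Y_1`, `H = −2Y_{−1} + 2Y_1`.
Membership `A ∈ End(V)^{j,−j}` means `A(V♯^{p,q}) ⊆ V♯^{p+j, q−j}` for all `p, q`.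
-/

/-- `c : ℂ` is a positive real number. -/
def posC (c : ℂ) : Prop := c.im = 0 ∧ 0 < c.re

/-- The exponential of a nilpotent endomorphism of a finite-dimensional space. -/
noncomputable def expEnd {V : Type*} [AddCommGroup V] [Module ℂ V] [FiniteDimensional ℂ V]
    (A : V →ₗ[ℂ] V) : V →ₗ[ℂ] V :=
  ∑ k ∈ Finset.range (Module.finrank ℂ V + 1), ((k.factorial : ℂ))⁻¹ • A ^ k

/-- The Weil element `w = e^X e^{−Y} e^X`. -/
noncomputable def weil {V : Type*} [AddCommGroup V] [Module ℂ V] [FiniteDimensional ℂ V]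
    (X Y : V →ₗ[ℂ] V) : V →ₗ[ℂ] V :=
  expEnd X ∘ₗ expEnd (-Y) ∘ₗ expEnd X

/-- The total Hodge filtration `F^p = ⊕_{i ≥ p, j} V^{i,j}` of a bigrading. -/
def totalF {V : Type*} [AddCommGroup V] [Module ℂ V]
    (Vb : ℤ → ℤ → Submodule ℂ V) (p : ℤ) : Submodule ℂ V :=
  ⨆ i : ℤ, ⨆ (_ : p ≤ i), ⨆ j : ℤ, Vb i j

/-- The conjugate total Hodge filtration `F̄^q = ⊕_{j ≥ q, i} V^{i,j}` of a bigrading. -/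
def totalFbar {V : Type*} [AddCommGroup V] [Module ℂ V]
    (Vb : ℤ → ℤ → Submodule ℂ V) (q : ℤ) : Submodule ℂ V :=
  ⨆ j : ℤ, ⨆ (_ : q ≤ j), ⨆ i : ℤ, Vb i j

/-- The subspace `V♯^{p, n−p} = (e^Y F)^p ∩ (e^{−Y} F̄)^{n−p}`. -/
noncomputable def Vsharp {V : Type*} [AddCommGroup V] [Module ℂ V] [FiniteDimensional ℂ V]
    (n : ℤ) (Y : V →ₗ[ℂ] V) (Vb : ℤ → ℤ → Submodule ℂ V) (p : ℤ) : Submodule ℂ V :=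
  Submodule.map (expEnd Y) (totalF Vb p) ⊓
    Submodule.map (expEnd (-Y)) (totalFbar Vb (n - p))

section Sl2Exponential

variable {A : Type*} [Ring A] [Algebra ℂ A]

/-- The `m`-th partial sum of the exponential series in a `ℂ`-algebra. -/
noncomputable def expPartialSum (y : A) (m : ℕ) : A :=
  ∑ k ∈ Finset.range m, ((k.factorial : ℂ))⁻¹ • y ^ k

theorem expPartialSum_succ (y : A) (m : ℕ) :
    expPartialSum y (m + 1) = expPartialSum y m + ((m.factorial : ℂ))⁻¹ • y ^ m :=
  Finset.sum_range_succ _ _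

theorem weight_mul_pow {h y : A} (hy : h * y = y * h - (2 : ℂ) • y) (k : ℕ) :
    h * y ^ k = y ^ k * h - (2 * k : ℂ) • y ^ k := by
  induction k with
  | zero => simp
  | succ k ih =>
    rw [pow_succ, ← mul_assoc, ih, sub_mul, mul_assoc, hy, smul_mul_assoc, mul_sub,
      mul_smul_comm, mul_assoc]
    push_cast
    module

theorem raising_mul_pow_succ {x h y : A} (hy : h * y = y * h - (2 : ℂ) • y)
    (hx : x * y = y * x + h) (k : ℕ) :
    x * y ^ (k + 1) = y ^ (k + 1) * x + (k + 1 : ℂ) • (y ^ k * h)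
      - (k * (k + 1) : ℂ) • y ^ k := by
  induction k with
  | zero => simp [hx]
  | succ k ih =>
    rw [pow_succ y (k + 1), ← mul_assoc, ih, sub_mul, add_mul, mul_assoc _ x, hx,
      smul_mul_assoc, smul_mul_assoc, mul_assoc _ h, hy, mul_add, mul_sub, mul_smul_comm,
      ← mul_assoc (y ^ k), ← pow_succ, ← mul_assoc (y ^ (k + 1)), ← pow_succ]
    push_cast
    module

theorem weight_mul_expPartialSum {h y : A} (hy : h * y = y * h - (2 : ℂ) • y) (m : ℕ) :
    h * expPartialSum y (m + 1) =
      expPartialSum y (m + 1) * h - (2 : ℂ) • (expPartialSum y m * y) := by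
  induction m with
  | zero => simp [expPartialSum]
  | succ m ih =>
    rw [expPartialSum_succ y (m + 1), mul_add, ih, mul_smul_comm, weight_mul_pow hy, add_mul,
      smul_mul_assoc]
    nth_rw 3 [expPartialSum_succ y m]
    rw [add_mul, smul_mul_assoc, ← pow_succ, Nat.factorial_succ]
    push_cast
    match_scalars <;> field_simp

theorem raising_mul_expPartialSum {x h y : A} (hy : h * y = y * h - (2 : ℂ) • y)
    (hx : x * y = y * x + h) (m : ℕ) :
    x * expPartialSum y (m + 2) =
      expPartialSum y (m + 2) * x + expPartialSum y (m + 1) * h - expPartialSum y m * y := by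
  induction m with
  | zero =>
    simp [expPartialSum, Finset.sum_range_succ, mul_add, add_mul, hx]
    abel
  | succ m ih =>
    have hm : (m + 1 + 1 : ℂ) ≠ 0 := by exact_mod_cast (m + 1).succ_ne_zero
    have e0 := expPartialSum_succ y m
    have e1 := expPartialSum_succ y (m + 1)
    have e2 := expPartialSum_succ y (m + 2)
    have key : ((m + 2).factorial : ℂ)⁻¹ • (x * y ^ (m + 2)) =
        ((m + 2).factorial : ℂ)⁻¹ • (y ^ (m + 2) * x)
          + ((m + 1).factorial : ℂ)⁻¹ • (y ^ (m + 1) * h)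
          - (m.factorial : ℂ)⁻¹ • y ^ (m + 1) := by
      rw [raising_mul_pow_succ hy hx, Nat.factorial_succ (m + 1), Nat.factorial_succ m]
      push_cast
      match_scalars <;> field_simp
    calc x * expPartialSum y (m + 1 + 2)
        = x * expPartialSum y (m + 2) + ((m + 2).factorial : ℂ)⁻¹ • (x * y ^ (m + 2)) := by
          rw [e2, mul_add, mul_smul_comm]
      _ = (expPartialSum y (m + 2) * x + ((m + 2).factorial : ℂ)⁻¹ • (y ^ (m + 2) * x))
          + (expPartialSum y (m + 1) * h + ((m + 1).factorial : ℂ)⁻¹ • (y ^ (m + 1) * h))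
          - (expPartialSum y m * y + (m.factorial : ℂ)⁻¹ • y ^ (m + 1)) := by
          rw [ih, key]; abel
      _ = _ := by
          rw [e2, e1, e0]
          simp only [add_mul, smul_mul_assoc, pow_succ]

end Sl2Exponential

section Lowering

variable {V : Type*} [AddCommGroup V] [Module ℂ V] [FiniteDimensional ℂ V]

theorem isNilpotent_of_weight_neg_two {H Y : Module.End ℂ V}
    (hy : H * Y = Y * H - (2 : ℂ) • Y) : IsNilpotent Y := by
  by_contra hY
  have hne : ∀ k : ℕ, Y ^ k ≠ 0 := fun k hk => hY ⟨k, hk⟩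
  let ad : Module.End ℂ (Module.End ℂ V) :=
    LinearMap.mulLeft ℂ H - LinearMap.mulRight ℂ H
  have hli : LinearIndependent ℂ (fun k : ℕ => Y ^ k) := by
    refine Module.End.eigenvectors_linearIndependent' ad (fun k : ℕ => -(2 * k : ℂ)) ?_ _ ?_
    · intro a b hab
      simpa using hab
    · intro k
      refine ⟨Module.End.mem_eigenspace_iff.mpr ?_, hne k⟩
      change H * Y ^ k - Y ^ k * H = _
      rw [weight_mul_pow hy]
      module
  exact not_finite_iff_infinite.mpr inferInstance hli.finite

theorem expEnd_eq_expPartialSum {Y : Module.End ℂ V} (hY : IsNilpotent Y) (r : ℕ) :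
    expPartialSum Y (Module.finrank ℂ V + r) = expEnd Y := by
  have hN : Y ^ Module.finrank ℂ V = 0 := by
    have := Y.aeval_self_charpoly
    rwa [IsNilpotent.charpoly_eq_X_pow_finrank hY, map_pow, Polynomial.aeval_X] at this
  have h0 : ∀ r, expPartialSum Y (Module.finrank ℂ V + r)
      = expPartialSum Y (Module.finrank ℂ V) := by
    intro r
    induction r with
    | zero => rfl
    | succ r ih => rw [← add_assoc, expPartialSum_succ, ih, pow_add, hN]; simp
  exact (h0 r).trans (h0 1).symm

theorem weight_mul_expEnd {H Y : Module.End ℂ V} (hy : H * Y = Y * H - (2 : ℂ) • Y) :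
    H * (expEnd Y : Module.End ℂ V) = (expEnd Y : Module.End ℂ V) * (H - (2 : ℂ) • Y) := by
  have hY := isNilpotent_of_weight_neg_two hy
  have := weight_mul_expPartialSum hy (Module.finrank ℂ V)
  rw [expEnd_eq_expPartialSum hY 1] at this
  have h0 := expEnd_eq_expPartialSum hY 0
  rw [add_zero] at h0
  rw [this, h0, mul_sub, mul_smul_comm]

theorem raising_mul_expEnd {X H Y : Module.End ℂ V} (hy : H * Y = Y * H - (2 : ℂ) • Y)
    (hx : X * Y = Y * X + H) :
    X * (expEnd Y : Module.End ℂ V) = (expEnd Y : Module.End ℂ V) * (X + H - Y) := by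
  have hY := isNilpotent_of_weight_neg_two hy
  have := raising_mul_expPartialSum hy hx (Module.finrank ℂ V)
  rw [expEnd_eq_expPartialSum hY 1, expEnd_eq_expPartialSum hY 2] at this
  have h0 := expEnd_eq_expPartialSum hY 0
  rw [add_zero] at h0
  rw [this, h0, mul_sub, mul_add]

theorem mul_expEnd_comm (Y : Module.End ℂ V) :
    Y * (expEnd Y : Module.End ℂ V) = (expEnd Y : Module.End ℂ V) * Y := by
  change Y * ∑ k ∈ _, _ = (∑ k ∈ _, _) * Y
  rw [Finset.mul_sum, Finset.sum_mul]
  refine Finset.sum_congr rfl fun k _ => ?_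
  change Y * ((k.factorial : ℂ)⁻¹ • Y ^ k) = ((k.factorial : ℂ)⁻¹ • Y ^ k) * Y
  rw [mul_smul_comm, smul_mul_assoc, ← pow_succ, ← pow_succ']

end Lowering

section Filtration

variable {V : Type*} [AddCommGroup V] [Module ℂ V] {Vb : ℤ → ℤ → Submodule ℂ V}

theorem map_totalF_le {A : V →ₗ[ℂ] V} {a b : ℤ}
    (hA : ∀ i j, ∀ v ∈ Vb i j, A v ∈ Vb (i + a) (j + b)) {p p' : ℤ} (hp : p' ≤ p + a) :
    totalF Vb p ≤ (totalF Vb p').comap A := by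
  refine iSup_le fun i => iSup_le fun hi => iSup_le fun j v hv => ?_
  have : Vb (i + a) (j + b) ≤ totalF Vb p' :=
    le_iSup_of_le (i + a) (le_iSup_of_le (by omega) (le_iSup (Vb (i + a)) (j + b)))
  exact this (hA i j v hv)

theorem map_totalFbar_le {A : V →ₗ[ℂ] V} {a b : ℤ}
    (hA : ∀ i j, ∀ v ∈ Vb i j, A v ∈ Vb (i + a) (j + b)) {q q' : ℤ} (hq : q' ≤ q + b) :
    totalFbar Vb q ≤ (totalFbar Vb q').comap A :=
  map_totalF_le (Vb := fun j i => Vb i j) (fun j i => hA i j) hq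

theorem map_map_le_of_comp_eq {A B E : V →ₗ[ℂ] V} {S T : Submodule ℂ V}
    (h : A ∘ₗ E = E ∘ₗ B) (hB : S ≤ T.comap B) :
    (S.map E).map A ≤ T.map E := by
  rw [← Submodule.map_comp, h, Submodule.map_comp]
  exact Submodule.map_mono (Submodule.map_le_iff_le_comap.mpr hB)

theorem map_Vsharp_le [FiniteDimensional ℂ V] {n p p' : ℤ} {Y A B C : V →ₗ[ℂ] V}
    (hB : A ∘ₗ expEnd Y = expEnd Y ∘ₗ B) (hC : A ∘ₗ expEnd (-Y) = expEnd (-Y) ∘ₗ C)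
    (hBF : ∀ v ∈ totalF Vb p, B v ∈ totalF Vb p')
    (hCF : ∀ v ∈ totalFbar Vb (n - p), C v ∈ totalFbar Vb (n - p')) (c : ℂ) :
    Submodule.map (c • A) (Vsharp n Y Vb p) ≤ Vsharp n Y Vb p' := by
  rintro _ ⟨v, ⟨hv, hv'⟩, rfl⟩
  exact Submodule.smul_mem _ _
    ⟨map_map_le_of_comp_eq hB hBF ⟨v, hv, rfl⟩, map_map_le_of_comp_eq hC hCF ⟨v, hv', rfl⟩⟩

end Filtration

theorem hodge_components_of_HXY
    {V : Type*} [AddCommGroup V] [Module ℂ V] [FiniteDimensional ℂ V]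
    (n : ℤ) (H X Y : V →ₗ[ℂ] V)
    (hHX : H ∘ₗ X - X ∘ₗ H = (2 : ℂ) • X)
    (hHY : H ∘ₗ Y - Y ∘ₗ H = (-2 : ℂ) • Y)
    (hXY : X ∘ₗ Y - Y ∘ₗ X = H)
    (Vb : ℤ → ℤ → Submodule ℂ V)
    (hdec : DirectSum.IsInternal (fun ij : ℤ × ℤ => Vb ij.1 ij.2))
    (hH : ∀ i j : ℤ, ∀ v ∈ Vb i j, H v = ((i + j - n : ℤ) : ℂ) • v)
    (hX : ∀ i j : ℤ, Submodule.map X (Vb i j) ≤ Vb (i + 1) (j + 1))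
    (hY : ∀ i j : ℤ, Submodule.map Y (Vb i j) ≤ Vb (i - 1) (j - 1))
    (Q : V →ₗ[ℂ] V →ₛₗ[starRingEnd ℂ] ℂ)
    (hherm : ∀ v w : V, Q w v = starRingEnd ℂ (Q v w))
    (hnd : ∀ v : V, (∀ w : V, Q v w = 0) → v = 0)
    (hQH : ∀ v w : V, Q (H v) w = -Q v (H w))
    (hQX : ∀ v w : V, Q (X v) w = Q v (X w))
    (hQY : ∀ v w : V, Q (Y v) w = Q v (Y w))
    (hpolorth : ∀ i j i' j' : ℤ, i + j = i' + j' → (i, j) ≠ (i', j') →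
      ∀ v ∈ Vb i j, ∀ v' ∈ Vb i' j', Q v (weil X Y v') = 0)
    (hpolpos : ∀ i j : ℤ, ∀ v ∈ Vb i j, v ≠ 0 → posC ((-1 : ℂ) ^ j * Q v (weil X Y v))) :
    -- `Y_{−1} = (Y − H − X)/4` lies in `End(V)^{−1,1}`,
    (∀ p : ℤ, Submodule.map ((4 : ℂ)⁻¹ • (Y - H - X)) (Vsharp n Y Vb p) ≤
      Vsharp n Y Vb (p - 1)) ∧
    -- `Y_0 = (Y + X)/2` lies in `End(V)^{0,0}`,
    (∀ p : ℤ, Submodule.map ((2 : ℂ)⁻¹ • (Y + X)) (Vsharp n Y Vb p) ≤ Vsharp n Y Vb p) ∧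
    -- `Y_1 = (Y + H − X)/4` lies in `End(V)^{1,−1}`,
    (∀ p : ℤ, Submodule.map ((4 : ℂ)⁻¹ • (Y + H - X)) (Vsharp n Y Vb p) ≤
      Vsharp n Y Vb (p + 1)) ∧
    -- and `Y = Y_{−1} + Y_0 + Y_1`, `X = −Y_{−1} + Y_0 − Y_1`, `H = −2Y_{−1} + 2Y_1`.
    Y = (4 : ℂ)⁻¹ • (Y - H - X) + (2 : ℂ)⁻¹ • (Y + X) + (4 : ℂ)⁻¹ • (Y + H - X) ∧
    X = -((4 : ℂ)⁻¹ • (Y - H - X)) + (2 : ℂ)⁻¹ • (Y + X) - (4 : ℂ)⁻¹ • (Y + H - X) ∧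
    H = (-2 : ℂ) • ((4 : ℂ)⁻¹ • (Y - H - X)) + (2 : ℂ) • ((4 : ℂ)⁻¹ • (Y + H - X)) := by
  have hy : (H * Y : Module.End ℂ V) = Y * H - (2 : ℂ) • Y := by
    have : (H * Y : Module.End ℂ V) - Y * H = (-2 : ℂ) • Y := hHY
    rw [eq_add_of_sub_eq this]; module
  have hx : (X * Y : Module.End ℂ V) = Y * X + H := by
    have : (X * Y : Module.End ℂ V) - Y * X = H := hXY
    rw [eq_add_of_sub_eq this, add_comm]
  have hy' : (H * -Y : Module.End ℂ V) = -Y * H - (2 : ℂ) • (-Y) := by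
    rw [mul_neg, hy, neg_mul]; module
  have hx' : (-X * -Y : Module.End ℂ V) = -Y * -X + H := by
    rw [neg_mul_neg, neg_mul_neg, hx]
  have cH := weight_mul_expEnd hy
  have cX := raising_mul_expEnd hy hx
  have cY := mul_expEnd_comm Y
  have cH' := weight_mul_expEnd hy'
  have cX' : (X * expEnd (-Y) : Module.End ℂ V) = expEnd (-Y) * (X - H - Y) := by
    rw [← neg_neg X, neg_mul, raising_mul_expEnd hy' hx', ← mul_neg]; congr 1; abel
  have cY' : (Y * expEnd (-Y) : Module.End ℂ V) = expEnd (-Y) * Y := by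
    rw [← neg_inj, ← neg_mul, ← mul_neg]; exact mul_expEnd_comm (-Y)
  have gH : ∀ i j, ∀ v ∈ Vb i j, H v ∈ Vb (i + 0) (j + 0) := fun i j v hv => by
    rw [hH i j v hv, add_zero, add_zero]; exact Submodule.smul_mem _ _ hv
  have gX : ∀ i j, ∀ v ∈ Vb i j, X v ∈ Vb (i + 1) (j + 1) :=
    fun i j v hv => hX i j ⟨v, hv, rfl⟩
  have gY : ∀ i j, ∀ v ∈ Vb i j, Y v ∈ Vb (i + -1) (j + -1) :=
    fun i j v hv => hY i j ⟨v, hv, rfl⟩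
  refine ⟨fun p => ?_, fun p => ?_, fun p => ?_, by module, by module, by module⟩
  · refine map_Vsharp_le (B := (4 : ℂ) • Y - (2 : ℂ) • H - X) (C := -X) ?_ ?_ ?_ ?_ _
    · change ((Y - H - X) * expEnd Y : Module.End ℂ V) = expEnd Y * _
      rw [sub_mul, sub_mul, cH, cX, cY, ← mul_sub, ← mul_sub]; congr 1; module
    · change ((Y - H - X) * expEnd (-Y) : Module.End ℂ V) = expEnd (-Y) * _
      rw [sub_mul, sub_mul, cH', cX', cY', ← mul_sub, ← mul_sub]; congr 1; module
    · intro v hv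
      exact sub_mem (sub_mem (Submodule.smul_mem _ _ (map_totalF_le gY (by omega) hv))
        (Submodule.smul_mem _ _ (map_totalF_le gH (by omega) hv)))
        (map_totalF_le gX (by omega) hv)
    · intro v hv
      exact neg_mem (map_totalFbar_le gX (by omega) hv)
  · refine map_Vsharp_le (B := X + H) (C := X - H) ?_ ?_ ?_ ?_ _
    · change ((Y + X) * expEnd Y : Module.End ℂ V) = expEnd Y * _
      rw [add_mul, cX, cY, ← mul_add]; congr 1; module
    · change ((Y + X) * expEnd (-Y) : Module.End ℂ V) = expEnd (-Y) * _
      rw [add_mul, cX', cY', ← mul_add]; congr 1; module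
    · intro v hv
      exact add_mem (map_totalF_le gX (by omega) hv) (map_totalF_le gH (by omega) hv)
    · intro v hv
      exact sub_mem (map_totalFbar_le gX (by omega) hv) (map_totalFbar_le gH (by omega) hv)
  · refine map_Vsharp_le (B := -X) (C := (4 : ℂ) • Y + (2 : ℂ) • H - X) ?_ ?_ ?_ ?_ _
    · change ((Y + H - X) * expEnd Y : Module.End ℂ V) = expEnd Y * _
      rw [sub_mul, add_mul, cH, cX, cY, ← mul_add, ← mul_sub]; congr 1; module
    · change ((Y + H - X) * expEnd (-Y) : Module.End ℂ V) = expEnd (-Y) * _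
      rw [sub_mul, add_mul, cH', cX', cY', ← mul_add, ← mul_sub]; congr 1; module
    · intro v hv
      exact neg_mem (map_totalF_le gX (by omega) hv)
    · intro v hv
      exact sub_mem (add_mem (Submodule.smul_mem _ _ (map_totalFbar_le gY (by omega) hv))
        (Submodule.smul_mem _ _ (map_totalFbar_le gH (by omega) hv)))
        (map_totalFbar_le gX (by omega) hv)
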